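/- For all real constants 0 ≤ η < 1 and C > 0, there exist a constant ε > 0 and a threshold Δ₀ such that for every integer Δ ≥ Δ₀, every integer m ≥ 2CΔ^{1+η}, and every integer r with 1 ≤ r ≤ ε·Δ^{(1−η)/3}, the chromatic number of the SET-LOCAL neighborhood graph satisfies χ(N^SL_r(m,Δ)) > C·Δ^{1+η}. (Equivalently, no r-round color reduction algorithm in the SET-LOCAL model with these parameters can produce a proper coloring with at most C·Δ^{1+η} colors.) -/

import Mathlib

/-- The type of potential `r`-round views over the color set `[m]`: a `0`-view is a
color, and an `(r+1)`-view is a pair of an `r`-view and a set of `r`-views. -/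
def ViewType (m : ℕ) : ℕ → Type
  | 0 => Fin m
  | r + 1 => ViewType m r × Set (ViewType m r)

/-- The `r`-view `S_r^G(v)` of a vertex `v` of a graph `G` whose vertices are colored
by `ψ`: `S_0^G(v) = ψ(v)` and `S_{r+1}^G(v) = (S_r^G(v), {S_r^G(u) : u ~ v})`,
where the second component is the *set* of the neighbors' `r`-views. -/
def view {m : ℕ} {α : Type} (G : SimpleGraph α) (ψ : α → Fin m) :
    (r : ℕ) → α → ViewType m r
  | 0, v => ψ v
  | r + 1, v => (view G ψ r v, {s | ∃ u, G.Adj v u ∧ view G ψ r u = s})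

/-- `x` is a realizable `r`-view for parameters `(m,Δ)`: it arises as the `r`-view of
some vertex of some finite tree of maximum degree at most `Δ` equipped with a proper
vertex coloring with colors in `[m]`. -/
def IsView (m Δ r : ℕ) (x : ViewType m r) : Prop :=
  ∃ (α : Type) (G : SimpleGraph α) (ψ : α → Fin m),
    Finite α ∧ G.IsTree ∧ (∀ v, (G.neighborSet v).ncard ≤ Δ) ∧
    (∀ u v, G.Adj u v → ψ u ≠ ψ v) ∧ ∃ v, view G ψ r v = x

/-- Two `r`-views occur at adjacent vertices of some properly `m`-colored finite tree
with maximum degree at most `Δ`. -/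
def ViewAdj (m Δ r : ℕ) (x y : ViewType m r) : Prop :=
  ∃ (α : Type) (G : SimpleGraph α) (ψ : α → Fin m),
    Finite α ∧ G.IsTree ∧ (∀ v, (G.neighborSet v).ncard ≤ Δ) ∧
    (∀ u v, G.Adj u v → ψ u ≠ ψ v) ∧
    ∃ u v, G.Adj u v ∧ view G ψ r u = x ∧ view G ψ r v = y

/-- The vertices of the `SET-LOCAL` neighborhood graph `N^SL_r(m,Δ)`:
all realizable `r`-views. -/
def NSLVert (m Δ r : ℕ) : Type := {x : ViewType m r // IsView m Δ r x}

/-- The `SET-LOCAL` neighborhood graph `N^SL_r(m,Δ)`: realizable `r`-views, with an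
edge between two views whenever they occur at adjacent vertices of some properly
`m`-colored finite tree with maximum degree at most `Δ`. -/
def NSL (m Δ r : ℕ) : SimpleGraph (NSLVert m Δ r) :=
  SimpleGraph.fromRel (fun x y => ViewAdj m Δ r x.val y.val)

/-- A set of vertices of a tournament, all of out-degree less than `k`, has at most `2 * k`
elements. -/
theorem card_le_of_outdegree_lt {α : Type*} [DecidableEq α] (W : Finset α) (R : α → α → Prop)
    [DecidableRel R] (k : ℕ) (hR : ∀ u ∈ W, ∀ v ∈ W, u ≠ v → R u v ∨ R v u)
    (hk : ∀ v ∈ W, (W.filter fun u => u ≠ v ∧ R v u).card < k) : W.card ≤ 2 * k := by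
  have h1 : (W.offDiag).card ≤ ∑ v ∈ W, 2 * (W.filter fun u => u ≠ v ∧ R v u).card := by
    have hsub : W.offDiag ⊆ (W.sigma fun v => W.filter fun u => u ≠ v ∧ R v u).image
          (fun p => (p.1, p.2)) ∪
        (W.sigma fun v => W.filter fun u => u ≠ v ∧ R v u).image (fun p => (p.2, p.1)) := by
      rintro ⟨a, b⟩ hab
      rw [Finset.mem_offDiag] at hab
      obtain ⟨ha, hb, hne⟩ := hab
      simp only [Finset.mem_union, Finset.mem_image, Finset.mem_sigma, Finset.mem_filter,
        Sigma.exists, Prod.mk.injEq]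
      rcases hR a ha b hb hne with h | h
      · exact Or.inl ⟨a, b, ⟨ha, hb, hne.symm, h⟩, rfl, rfl⟩
      · exact Or.inr ⟨b, a, ⟨hb, ha, hne, h⟩, rfl, rfl⟩
    refine (Finset.card_le_card hsub).trans ((Finset.card_union_le _ _).trans ?_)
    refine (Nat.add_le_add Finset.card_image_le Finset.card_image_le).trans ?_
    rw [Finset.card_sigma, ← Finset.mul_sum, two_mul]
  rw [Finset.offDiag_card] at h1
  have h2 : ∑ v ∈ W, 2 * (W.filter fun u => u ≠ v ∧ R v u).card ≤ W.card * (2 * (k - 1)) := by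
    rw [← smul_eq_mul]
    refine Finset.sum_le_card_nsmul _ _ _ fun v hv => ?_
    have := hk v hv
    omega
  rcases W.card.eq_zero_or_pos with h0 | h0
  · omega
  · obtain ⟨v, hv⟩ := Finset.card_pos.mp h0
    have hk1 := hk v hv
    have h3 := h1.trans h2
    rw [← Nat.mul_sub_one] at h3
    have := Nat.le_of_mul_le_mul_left h3 h0
    omega

/-- Greedy hitting sets: after `n` choices, the number of sets not yet hit has shrunk by a
factor `(1 - k / s) ^ n`. -/
theorem exists_hitting_set {α ι : Type*} [DecidableEq α] (Q : Finset α) (F : Finset ι)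
    (B : ι → Finset α) (k : ℕ) (hB : ∀ i ∈ F, B i ⊆ Q ∧ k ≤ (B i).card) (hQ : 0 < Q.card)
    (n : ℕ) : ∃ T ⊆ Q, T.card ≤ n ∧
      (F.filter fun i => Disjoint T (B i)).card * Q.card ^ n ≤ F.card * (Q.card - k) ^ n := by
  induction n with
  | zero => exact ⟨∅, by simp, by simp, by simp⟩
  | succ n ih =>
    obtain ⟨T, hTQ, hTn, hT⟩ := ih
    set U := F.filter fun i => Disjoint T (B i) with hU
    have hsum : ∑ u ∈ Q, (U.filter fun i => u ∉ B i).card ≤ U.card * (Q.card - k) := by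
      simp_rw [Finset.card_filter]
      rw [Finset.sum_comm, ← smul_eq_mul]
      refine Finset.sum_le_card_nsmul _ _ _ fun i hi => ?_
      have hi' := hB i (Finset.mem_filter.mp hi).1
      rw [← Finset.card_filter, Finset.filter_notMem_eq_sdiff,
        Finset.card_sdiff_of_subset hi'.1]
      omega
    obtain ⟨u, hu, hmin⟩ : ∃ u ∈ Q, (U.filter fun i => u ∉ B i).card * Q.card
        ≤ U.card * (Q.card - k) := by
      obtain ⟨u, hu, hmin⟩ := Finset.exists_min_image Q
        (fun u => (U.filter fun i => u ∉ B i).card) (Finset.card_pos.mp hQ)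
      refine ⟨u, hu, le_trans ?_ hsum⟩
      rw [mul_comm, ← smul_eq_mul]
      exact Finset.card_nsmul_le_sum _ _ _ hmin
    refine ⟨insert u T, Finset.insert_subset hu hTQ, (Finset.card_insert_le _ _).trans (by omega),
      ?_⟩
    have hEq : (F.filter fun i => Disjoint (insert u T) (B i)) = U.filter fun i => u ∉ B i := by
      ext i
      simp only [hU, Finset.mem_filter, Finset.disjoint_insert_left]
      tauto
    rw [hEq]
    calc (U.filter fun i => u ∉ B i).card * Q.card ^ (n + 1)
        = (U.filter fun i => u ∉ B i).card * Q.card * Q.card ^ n := by ring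
      _ ≤ U.card * (Q.card - k) * Q.card ^ n := Nat.mul_le_mul_right _ hmin
      _ = U.card * Q.card ^ n * (Q.card - k) := by ring
      _ ≤ F.card * (Q.card - k) ^ n * (Q.card - k) := Nat.mul_le_mul_right _ hT
      _ = _ := by ring

/-- Given `c` tournaments on the same vertex set, some vertex `v` has an out-neighbor in a
small common set `T` for all but a few of the tournaments. -/
theorem exists_dominated_vertex {α : Type*} (Q : Finset α) (c k : ℕ) (R : ℕ → α → α → Prop)
    (hR : ∀ i < c, ∀ u ∈ Q, ∀ v ∈ Q, u ≠ v → R i u v ∨ R i v u) (hQ : 0 < Q.card)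
    (hk : 4 * k * c ≤ Q.card ^ 2) (hc : c * (Q.card - k) ^ (Q.card / 2) < Q.card ^ (Q.card / 2)) :
    ∃ v ∈ Q, ∃ T ⊆ Q, ∃ J ⊆ Finset.range c, T.card + J.card ≤ Q.card ∧
      ∀ i < c, i ∈ J ∨ ∃ u ∈ T, u ≠ v ∧ R i v u := by
  classical
  let B : ℕ → α → Finset α := fun i v => Q.filter fun u => u ≠ v ∧ R i v u
  have hsmall : ∀ i ∈ Finset.range c, (Q.filter fun v => (B i v).card < k).card ≤ 2 * k := by
    intro i hi
    rw [Finset.mem_range] at hi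
    refine card_le_of_outdegree_lt _ (R i) k ?_ ?_
    · intro u hu v hv
      exact hR i hi u (Finset.mem_filter.mp hu).1 v (Finset.mem_filter.mp hv).1
    · intro v hv
      refine lt_of_le_of_lt (Finset.card_le_card ?_) (Finset.mem_filter.mp hv).2
      exact Finset.filter_subset_filter _ (Finset.filter_subset _ _)
  obtain ⟨v, hv, hvs⟩ : ∃ v ∈ Q, Q.card * ((Finset.range c).filter fun i => (B i v).card < k).card
      ≤ c * (2 * k) := by
    obtain ⟨v, hv, hmin⟩ := Finset.exists_min_image Q
      (fun v => ((Finset.range c).filter fun i => (B i v).card < k).card) (Finset.card_pos.mp hQ)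
    refine ⟨v, hv, ?_⟩
    rw [← smul_eq_mul]
    refine (Finset.card_nsmul_le_sum _ _ _ hmin).trans ?_
    simp_rw [Finset.card_filter]
    rw [Finset.sum_comm]
    simp_rw [← Finset.card_filter]
    refine (Finset.sum_le_card_nsmul _ _ _ hsmall).trans ?_
    simp
  set J := (Finset.range c).filter fun i => (B i v).card < k with hJ
  obtain ⟨T, hTQ, hTn, hT⟩ := exists_hitting_set Q
    ((Finset.range c).filter fun i => k ≤ (B i v).card) (fun i => B i v) k
    (fun i hi => ⟨Finset.filter_subset _ _, (Finset.mem_filter.mp hi).2⟩) hQ (Q.card / 2)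
  refine ⟨v, hv, T, hTQ, J, Finset.filter_subset _ _, ?_, ?_⟩
  · have : 2 * J.card ≤ Q.card := by
      refine Nat.le_of_mul_le_mul_left ?_ hQ
      nlinarith
    omega
  · intro i hi
    by_cases hik : (B i v).card < k
    · exact Or.inl (Finset.mem_filter.mpr ⟨Finset.mem_range.mpr hi, hik⟩)
    · right
      have hF : ((Finset.range c).filter fun i => k ≤ (B i v).card).card ≤ c := by
        simpa using Finset.card_filter_le (Finset.range c) fun i => k ≤ (B i v).card
      have hlt := (hT.trans (Nat.mul_le_mul_right _ hF)).trans_lt hc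
      have h0 : (((Finset.range c).filter fun i => k ≤ (B i v).card).filter
          fun i => Disjoint T (B i v)).card = 0 := by
        by_contra hne
        exact absurd hlt (not_lt.mpr (Nat.le_mul_of_pos_left _ (Nat.pos_of_ne_zero hne)))
      rw [Finset.card_eq_zero, Finset.filter_eq_empty_iff] at h0
      have := h0 (Finset.mem_filter.mpr ⟨Finset.mem_range.mpr hi, not_lt.mp hik⟩)
      rw [Finset.not_disjoint_iff] at this
      obtain ⟨u, huT, huB⟩ := this
      exact ⟨u, huT, (Finset.mem_filter.mp huB).2⟩

section Views

variable {m : ℕ}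

instance (n : ℕ) : Finite (ViewType m n) := by
  induction n with
  | zero => exact inferInstanceAs (Finite (Fin m))
  | succ n ih => exact inferInstanceAs (Finite (ViewType m n × Set (ViewType m n)))

namespace ViewType

/-- The `n`-view contained in an `(n+1)`-view. -/
def prev {n : ℕ} (x : ViewType m (n + 1)) : ViewType m n := Prod.fst x

/-- The set of the neighbors' `n`-views recorded by an `(n+1)`-view. -/
def nbrs {n : ℕ} (x : ViewType m (n + 1)) : Set (ViewType m n) := Prod.snd x

/-- The `(n+1)`-view with given `n`-view and set of neighbors' `n`-views. -/
def extend {n : ℕ} (x : ViewType m n) (S : Set (ViewType m n)) : ViewType m (n + 1) := (x, S)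

@[simp] theorem prev_extend {n : ℕ} (x : ViewType m n) (S : Set (ViewType m n)) :
    (extend x S).prev = x := rfl

@[simp] theorem nbrs_extend {n : ℕ} (x : ViewType m n) (S : Set (ViewType m n)) :
    (extend x S).nbrs = S := rfl

/-- The color of the vertex a view is centered at. -/
def label : (n : ℕ) → ViewType m n → Fin m
  | 0, x => x
  | n + 1, x => label n x.prev

/-- Compatibility of two views as views of adjacent vertices. -/
def Compat : (n : ℕ) → ViewType m n → ViewType m n → Prop
  | 0, x, y => x ≠ y
  | _ + 1, x, y => y.prev ∈ x.nbrs ∧ x.prev ∈ y.nbrs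

theorem Compat.symm : {n : ℕ} → {x y : ViewType m n} → Compat n x y → Compat n y x
  | 0, _, _, h => Ne.symm h
  | _ + 1, _, _, h => ⟨h.2, h.1⟩

/-- The set of neighbors' views recorded by a view, if there is one. -/
def Record (m : ℕ) : ℕ → Type
  | 0 => Unit
  | n + 1 => Set (ViewType m n)

/-- The outermost set of neighbors' views of a view. -/
def record : (n : ℕ) → ViewType m n → Record m n
  | 0, _ => ()
  | _ + 1, x => x.nbrs

/-- A set of `n`-views restricts to a given set of `(n-1)`-views; there is no condition
if `n = 0`. -/
def Covers : (n : ℕ) → Record m n → Set (ViewType m n) → Prop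
  | 0, _, _ => True
  | _ + 1, p, X => Set.image prev X = p

/-- Abstract `n`-views with labels in `V` in which every vertex sees at most `D` different
neighbor views. -/
def Valid (V : Set (Fin m)) (D : ℕ) : (n : ℕ) → ViewType m n → Prop
  | 0, x => x ∈ V
  | n + 1, x => Valid V D n x.prev ∧ x.nbrs.ncard ≤ D ∧
      (∀ y ∈ x.nbrs, Valid V D n y ∧ Compat n x.prev y) ∧ Covers n (record n x.prev) x.nbrs

theorem Valid.mono {V : Set (Fin m)} {D D' : ℕ} (hD : D ≤ D') :
    {n : ℕ} → {x : ViewType m n} → Valid V D n x → Valid V D' n x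
  | 0, _, h => h
  | _ + 1, _, h => ⟨h.1.mono hD, h.2.1.trans hD,
      fun y hy => ⟨(h.2.2.1 y hy).1.mono hD, (h.2.2.1 y hy).2⟩, h.2.2.2⟩

theorem Valid.label_ne {V : Set (Fin m)} {D : ℕ} :
    {n : ℕ} → {x y : ViewType m n} → Valid V D n x → Compat n x y → label n x ≠ label n y
  | 0, _, _, _, h => h
  | _ + 1, _, _, hx, h => hx.1.label_ne (hx.2.2.1 _ h.1).2

/-- Compatible views can be extended to views one of which records the other. -/
theorem Valid.exists_extend {V : Set (Fin m)} {D : ℕ} (hD : 1 ≤ D) :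
    {n : ℕ} → {x y : ViewType m n} → Valid V D n x → Valid V D n y → Compat n x y →
      ∃ T, x ∈ T ∧ Valid V D (n + 1) (extend y T)
  | 0, x, y, hx, hy, h => by
    refine ⟨{x}, rfl, hy, ?_, ?_, trivial⟩
    · simpa using hD
    · rintro z rfl
      exact ⟨hx, h.symm⟩
  | n + 1, x, y, hx, hy, h => by
    classical
    have hg : ∀ z ∈ y.nbrs, ∃ Z : ViewType m (n + 1), Z.prev = z ∧ Valid V D (n + 1) Z ∧
        Compat (n + 1) y Z := by
      intro z hz
      obtain ⟨T, hT, hTv⟩ := hy.1.exists_extend hD (hy.2.2.1 z hz).1 (hy.2.2.1 z hz).2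
      exact ⟨extend z T, rfl, hTv, hz, hT⟩
    have : Nonempty (ViewType m (n + 1)) := ⟨y⟩
    choose! g hg1 hg2 hg3 using hg
    set g' : ViewType m n → ViewType m (n + 1) := fun z => if z = x.prev then x else g z with hg'
    have hg'p : ∀ z ∈ y.nbrs, (g' z).prev = z := by
      intro z hz
      by_cases hzx : z = x.prev
      · simp [hg', hzx]
      · simp [hg', hzx, hg1 z hz]
    refine ⟨g' '' y.nbrs, ⟨x.prev, h.2, by simp [hg']⟩, hy,
      (Set.ncard_image_le (Set.toFinite _)).trans hy.2.1, ?_, ?_⟩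
    · rintro _ ⟨z, hz, rfl⟩
      by_cases hzx : z = x.prev
      · simpa [hg', hzx] using ⟨hx, h.symm⟩
      · simpa [hg', hzx] using ⟨hg2 z hz, hg3 z hz⟩
    · change prev '' (g' '' y.nbrs) = y.nbrs
      rw [Set.image_image]
      exact (Set.image_congr hg'p).trans (Set.image_id' _)

theorem Valid.exists_covers {V : Set (Fin m)} {D : ℕ} (hD : 1 ≤ D) :
    {n : ℕ} → {x : ViewType m n} → Valid V D n x → ∃ S : Set (ViewType m n), S.ncard ≤ D ∧
      (∀ y ∈ S, Valid V D n y ∧ Compat n x y) ∧ Covers n (record n x) S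
  | 0, _, _ => ⟨∅, by simp, by simp, trivial⟩
  | n + 1, x, hx => by
    have hg : ∀ z ∈ x.nbrs, ∃ Z : ViewType m (n + 1), Z.prev = z ∧ Valid V D (n + 1) Z ∧
        Compat (n + 1) x Z := by
      intro z hz
      obtain ⟨T, hT, hTv⟩ := hx.1.exists_extend hD (hx.2.2.1 z hz).1 (hx.2.2.1 z hz).2
      exact ⟨extend z T, rfl, hTv, hz, hT⟩
    have : Nonempty (ViewType m (n + 1)) := ⟨x⟩
    choose! g hg1 hg2 hg3 using hg
    refine ⟨g '' x.nbrs, (Set.ncard_image_le (Set.toFinite _)).trans hx.2.1, ?_, ?_⟩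
    · rintro _ ⟨z, hz, rfl⟩
      exact ⟨hg2 z hz, hg3 z hz⟩
    · change prev '' (g '' x.nbrs) = x.nbrs
      rw [Set.image_image]
      exact (Set.image_congr hg1).trans (Set.image_id' _)

theorem Covers.union {n : ℕ} {x : ViewType m n} {S T : Set (ViewType m n)}
    (hS : Covers n (record n x) S) (hT : ∀ y ∈ T, Compat n x y) :
    Covers n (record n x) (S ∪ T) := by
  cases n with
  | zero => trivial
  | succ n =>
    change prev '' (S ∪ T) = x.nbrs
    have hS' : prev '' S = x.nbrs := hS
    rw [Set.image_union, hS', Set.union_eq_left]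
    rintro _ ⟨y, hy, rfl⟩
    exact (hT y hy).1

/-- `IsTrunc w n z` says that the `i`-view `w` is the `i`-round part of the `n`-view `z`. -/
inductive IsTrunc {i : ℕ} (w : ViewType m i) : (n : ℕ) → ViewType m n → Prop
  | refl : IsTrunc w i w
  | step {n : ℕ} {z : ViewType m (n + 1)} : IsTrunc w n z.prev → IsTrunc w (n + 1) z

namespace IsTrunc

theorem le {i n : ℕ} {w : ViewType m i} {z : ViewType m n} (h : IsTrunc w n z) : i ≤ n := by
  induction h with
  | refl => exact le_rfl
  | step _ ih => omega

theorem eq {n : ℕ} {w z : ViewType m n} (h : IsTrunc w n z) : w = z := by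
  cases h with
  | refl => rfl
  | step h => exact absurd h.le (by omega)

theorem of_succ {i n : ℕ} {w : ViewType m i} {z : ViewType m (n + 1)} (h : IsTrunc w (n + 1) z)
    (hi : i ≤ n) : IsTrunc w n z.prev := by
  cases h with
  | refl => omega
  | step h => exact h

theorem exists_of_le {i n : ℕ} (hi : i ≤ n) (z : ViewType m n) :
    ∃ w : ViewType m i, IsTrunc w n z := by
  induction n, hi using Nat.le_induction with
  | base => exact ⟨z, refl⟩
  | succ n _ ih =>
    obtain ⟨w, hw⟩ := ih z.prev
    exact ⟨w, hw.step⟩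

theorem prev {i n : ℕ} {w : ViewType m (i + 1)} {z : ViewType m n} (h : IsTrunc w n z) :
    IsTrunc w.prev n z := by
  induction h with
  | refl => exact step refl
  | step _ ih => exact step ih

theorem label_eq {i n : ℕ} {w : ViewType m i} {z : ViewType m n} (h : IsTrunc w n z) :
    label n z = label i w := by
  induction h with
  | refl => rfl
  | step _ ih => exact ih

theorem mem_nbrs_iff {V : Set (Fin m)} {D i n : ℕ} {w : ViewType m (i + 1)}
    {z : ViewType m (n + 1)} (h : IsTrunc w (n + 1) z) (hz : Valid V D (n + 1) z)
    (s' : ViewType m i) : s' ∈ w.nbrs ↔ ∃ s ∈ z.nbrs, IsTrunc s' n s := by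
  induction n with
  | zero =>
    obtain rfl : i = 0 := by have := h.le; omega
    obtain rfl := h.eq
    exact ⟨fun hs => ⟨s', hs, refl⟩, fun ⟨s, hs, hs'⟩ => hs'.eq ▸ hs⟩
  | succ n ih =>
    by_cases hi : i = n + 1
    · subst hi
      obtain rfl := h.eq
      exact ⟨fun hs => ⟨s', hs, refl⟩, fun ⟨s, hs, hs'⟩ => hs'.eq ▸ hs⟩
    · have hle := h.le
      rw [ih (h.of_succ (by omega)) hz.1]
      have hcov : ViewType.prev '' z.nbrs = z.prev.nbrs := hz.2.2.2
      rw [← hcov]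
      constructor
      · rintro ⟨_, ⟨t, ht, rfl⟩, hs⟩
        exact ⟨t, ht, hs.step⟩
      · rintro ⟨t, ht, hs⟩
        exact ⟨_, ⟨t, ht, rfl⟩, hs.of_succ (by omega)⟩

end IsTrunc

/-- A downward path in the tree unfolding of a view `Z`, ending at a vertex whose `j`-view
is to be the second index. -/
inductive Path {J : ℕ} (Z : ViewType m J) : (j : ℕ) → ViewType m j → Type
  | root : Path Z J Z
  | child {j : ℕ} {z : ViewType m (j + 1)} (p : Path Z (j + 1) z) (s : ViewType m j)
      (h : s ∈ z.nbrs) : Path Z j s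

/-- The vertices of the tree unfolding of a view. -/
structure Node {J : ℕ} (Z : ViewType m J) : Type where
  level : ℕ
  assigned : ViewType m level
  path : Path Z level assigned

namespace Node

variable {J : ℕ} {Z : ViewType m J}

/-- The parent of a vertex in the tree unfolding. -/
def parent : Node Z → Option (Node Z)
  | ⟨_, _, .root⟩ => none
  | ⟨_, _, .child p _ _⟩ => some ⟨_, _, p⟩

/-- The color of a vertex in the tree unfolding. -/
def color (a : Node Z) : Fin m := label a.level a.assigned

theorem parent_eq_some {j : ℕ} {z : ViewType m (j + 1)} {p : Path Z (j + 1) z} {b : Node Z} :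
    parent b = some ⟨j + 1, z, p⟩ ↔
      ∃ (s : ViewType m j) (h : s ∈ z.nbrs), b = ⟨j, s, .child p s h⟩ := by
  constructor
  · intro h
    rcases b with ⟨_, _, _ | ⟨p', s, hs⟩⟩
    · simp [parent] at h
    · simp only [parent, Option.some.injEq] at h
      cases h
      exact ⟨_, hs, rfl⟩
  · rintro ⟨s, h, rfl⟩
    rfl

theorem level_parent {a b : Node Z} (h : parent b = some a) : a.level = b.level + 1 := by
  rcases b with ⟨_, _, _ | ⟨p', s, hs⟩⟩
  · simp [parent] at h
  · simp only [parent, Option.some.injEq] at h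
    cases h
    rfl

theorem level_le (a : Node Z) : a.level ≤ J := by
  obtain ⟨j, z, p⟩ := a
  induction p with
  | root => exact le_rfl
  | child p s h ih => dsimp only at ih ⊢; omega

theorem valid {V : Set (Fin m)} {D : ℕ} (hZ : Valid V D J Z) (a : Node Z) :
    Valid V D a.level a.assigned := by
  obtain ⟨j, z, p⟩ := a
  induction p with
  | root => exact hZ
  | child p s h ih => exact (ih.2.2.1 s h).1

theorem children_finite (a : Node Z) : {b : Node Z | parent b = some a}.Finite := by
  obtain ⟨_ | j, z, p⟩ := a
  · refine Set.Finite.subset Set.finite_empty fun b hb => ?_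
    have := level_parent hb
    simp at this
  · refine (Set.finite_range fun s : z.nbrs => (⟨j, s.1, .child p s.1 s.2⟩ : Node Z)).subset ?_
    intro b hb
    obtain ⟨s, h, rfl⟩ := parent_eq_some.mp hb
    exact ⟨⟨s, h⟩, rfl⟩

theorem ncard_children_le {V : Set (Fin m)} {D : ℕ} (hZ : Valid V D J Z) (a : Node Z) :
    {b : Node Z | parent b = some a}.ncard ≤ D := by
  obtain ⟨_ | j, z, p⟩ := a
  · have : {b : Node Z | parent b = some ⟨0, z, p⟩} = ∅ := by
      refine Set.eq_empty_of_forall_notMem fun b hb => ?_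
      have := level_parent hb
      simp at this
    simp [this]
  · have hsub : {b : Node Z | parent b = some ⟨j + 1, z, p⟩} ⊆
        Set.range fun s : z.nbrs => (⟨j, s.1, .child p s.1 s.2⟩ : Node Z) := by
      intro b hb
      obtain ⟨s, h, rfl⟩ := parent_eq_some.mp hb
      exact ⟨⟨s, h⟩, rfl⟩
    refine (Set.ncard_le_ncard hsub (Set.finite_range _)).trans ?_
    rw [← Set.image_univ]
    refine (Set.ncard_image_le (Set.toFinite _)).trans ?_
    rw [Set.ncard_univ]
    exact (valid hZ ⟨j + 1, z, p⟩).2.1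

theorem eq_root_of_parent_eq_none {a : Node Z} (h : parent a = none) : a = ⟨J, Z, .root⟩ := by
  rcases a with ⟨_, _, _ | ⟨p', s, hs⟩⟩
  · rfl
  · simp [parent] at h

instance : Finite (Node Z) := by
  have h : ∀ i, {a : Node Z | a.level + i = J}.Finite := by
    intro i
    induction i with
    | zero =>
      refine (Set.finite_singleton (⟨J, Z, .root⟩ : Node Z)).subset fun a ha => ?_
      cases hp : parent a with
      | none => exact eq_root_of_parent_eq_none hp
      | some b =>
        have h1 := level_parent hp
        have h2 := level_le b
        have h3 : a.level + 0 = J := ha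
        omega
    | succ i ih =>
      refine ((Set.finite_singleton (⟨J, Z, .root⟩ : Node Z)).union
        (ih.biUnion fun a _ => children_finite a)).subset fun a ha => ?_
      cases hp : parent a with
      | none => exact Or.inl (eq_root_of_parent_eq_none hp)
      | some b =>
        have h1 := level_parent hp
        have h3 : a.level + (i + 1) = J := ha
        refine Or.inr (Set.mem_biUnion (x := b) ?_ hp)
        change b.level + i = J
        omega
  refine Set.finite_univ_iff.mp (((Set.finite_Iic J).biUnion fun i _ => h i).subset fun a _ => ?_)
  have := level_le a
  exact Set.mem_biUnion (x := J - a.level) (by simp) (by change a.level + (J - a.level) = J; omega)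

/-- The tree unfolding of a view. -/
def tree (Z : ViewType m J) : SimpleGraph (Node Z) where
  Adj a b := parent a = some b ∨ parent b = some a
  symm := ⟨fun _ _ h => h.symm⟩
  loopless := ⟨fun a h => by
    have := level_parent (h.elim id id : parent a = some a)
    omega⟩

theorem tree_connected : (tree Z).Connected := by
  have h : ∀ a : Node Z, (tree Z).Reachable a ⟨J, Z, .root⟩ := by
    rintro ⟨j, z, p⟩
    induction p with
    | root => exact SimpleGraph.Reachable.refl _
    | child p s h ih =>
      refine SimpleGraph.Reachable.trans (SimpleGraph.Adj.reachable ?_) ih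
      exact Or.inl rfl
  exact { preconnected := fun a b => (h a).trans (h b).symm, nonempty := ⟨⟨J, Z, .root⟩⟩ }

theorem tree_isTree : (tree Z).IsTree := by
  classical
  rw [SimpleGraph.isTree_iff_connected_and_card]
  refine ⟨tree_connected, le_antisymm ?_ tree_connected.card_vert_le_card_edgeSet_add_one⟩
  let f : Node Z → Sym2 (Node Z) := fun a => s(a, (parent a).getD a)
  have hsub : (tree Z).edgeSet ⊆ f '' {a | a ≠ ⟨J, Z, .root⟩} := by
    rintro ⟨a, b⟩ hab
    rcases (show parent a = some b ∨ parent b = some a from hab) with h | h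
    · refine ⟨a, ?_, ?_⟩
      · rintro rfl
        simp [parent] at h
      · simp [f, h]
    · refine ⟨b, ?_, ?_⟩
      · rintro rfl
        simp [parent] at h
      · simp only [f, h, Option.getD_some]
        exact Sym2.eq_swap
  have h1 : (tree Z).edgeSet.ncard ≤ ({⟨J, Z, .root⟩}ᶜ : Set (Node Z)).ncard :=
    (Set.ncard_le_ncard hsub (Set.toFinite _)).trans (Set.ncard_image_le (Set.toFinite _))
  have h2 := Set.ncard_add_ncard_compl ({⟨J, Z, .root⟩} : Set (Node Z))
  rw [Set.ncard_singleton] at h2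
  rw [Nat.card_coe_set_eq]
  omega

theorem color_ne_of_adj {V : Set (Fin m)} {D : ℕ} (hZ : Valid V D J Z) {a b : Node Z}
    (h : (tree Z).Adj a b) : color a ≠ color b := by
  have key : ∀ {a b : Node Z}, parent b = some a → color a ≠ color b := by
    rintro ⟨_, _, p⟩ b hb
    obtain ⟨j, rfl⟩ := Nat.exists_eq_succ_of_ne_zero
      (Nat.ne_zero_of_lt (Nat.lt_of_lt_of_eq (Nat.lt_succ_self _) (level_parent hb).symm))
    obtain ⟨s, hs, rfl⟩ := parent_eq_some.mp hb
    have hv := valid hZ ⟨_, _, p⟩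
    exact hv.1.label_ne (hv.2.2.1 s hs).2
  rcases h with h | h
  · exact (key h).symm
  · exact key h

theorem ncard_neighborSet_le {V : Set (Fin m)} {D : ℕ} (hZ : Valid V D J Z) (a : Node Z) :
    ((tree Z).neighborSet a).ncard ≤ D + 1 := by
  have hsub : (tree Z).neighborSet a ⊆ {b | parent b = some a} ∪ {(parent a).getD a} := by
    rintro b (h | h)
    · exact Or.inr (by simp [h])
    · exact Or.inl h
  refine (Set.ncard_le_ncard hsub (Set.toFinite _)).trans ((Set.ncard_union_le _ _).trans ?_)
  rw [Set.ncard_singleton]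
  exact Nat.add_le_add_right (ncard_children_le hZ a) 1

theorem view_tree {V : Set (Fin m)} {D : ℕ} (hZ : Valid V D J Z) (i : ℕ) (a : Node Z)
    (w : ViewType m i) (hw : IsTrunc w a.level a.assigned) : view (tree Z) color i a = w := by
  induction i generalizing a with
  | zero => exact hw.label_eq
  | succ i ih =>
    obtain ⟨j, z, p⟩ := a
    obtain ⟨j, rfl⟩ := Nat.exists_eq_succ_of_ne_zero (Nat.ne_zero_of_lt hw.le)
    have hij : i ≤ j := Nat.le_of_succ_le_succ hw.le
    have hz := valid hZ ⟨_, z, p⟩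
    refine Prod.ext (ih _ _ hw.prev) (Set.ext fun s' => ?_)
    refine Iff.trans ?_ (hw.mem_nbrs_iff hz s').symm
    constructor
    · rintro ⟨u, hu | hu, rfl⟩
      · obtain ⟨_, y, q⟩ := u
        obtain rfl := level_parent hu
        obtain ⟨s, hs, he⟩ := parent_eq_some.mp hu
        obtain rfl : z = s := by injection he
        have hc : Compat (j + 1) y.prev z := ((valid hZ ⟨_, y, q⟩).2.2.1 z hs).2
        obtain ⟨w', hw'⟩ := IsTrunc.exists_of_le hij y.prev.prev
        exact ⟨_, hc.2, (ih ⟨_, y, q⟩ w' hw'.step.step).symm ▸ hw'⟩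
      · obtain ⟨s, hs, rfl⟩ := parent_eq_some.mp hu
        obtain ⟨w', hw'⟩ := IsTrunc.exists_of_le hij s
        exact ⟨s, hs, (ih ⟨j, s, _⟩ w' hw').symm ▸ hw'⟩
    · rintro ⟨s, hs, hs'⟩
      exact ⟨⟨j, s, .child p s hs⟩, Or.inr rfl, ih ⟨j, s, _⟩ _ hs'⟩

end Node

theorem Valid.isView {V : Set (Fin m)} {D Δ r : ℕ} (hD : D + 1 ≤ Δ) {x : ViewType m r}
    (hx : Valid V D r x) : IsView m Δ r x :=
  ⟨Node x, Node.tree x, Node.color, inferInstance, Node.tree_isTree,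
    fun v => (Node.ncard_neighborSet_le hx v).trans hD, fun _ _ => Node.color_ne_of_adj hx,
    ⟨r, x, .root⟩, Node.view_tree hx _ _ _ .refl⟩

theorem Valid.viewAdj {V : Set (Fin m)} {D Δ r : ℕ} (hD1 : 1 ≤ D) (hD : D + 1 ≤ Δ)
    {x y : ViewType m r} (hx : Valid V D r x) (hy : Valid V D r y) (h : Compat r x y) :
    ViewAdj m Δ r x y := by
  obtain ⟨T, hT, hTv⟩ := hy.exists_extend hD1 hx h.symm
  exact ⟨Node (extend x T), Node.tree _, Node.color, inferInstance, Node.tree_isTree,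
    fun v => (Node.ncard_neighborSet_le hTv v).trans hD, fun _ _ => Node.color_ne_of_adj hTv,
    ⟨r + 1, _, .root⟩, ⟨r, y, .child .root y hT⟩, Or.inr rfl,
    Node.view_tree hTv _ _ _ (.step .refl), Node.view_tree hTv _ _ _ .refl⟩

end ViewType

end Views

section Reduction

open ViewType

variable {m : ℕ}

/-- The abstract `t`-views with parameters `V` and `D` have a proper coloring with `c` colors
(for convenience extended to views of all radii). -/
def ViewColorable (V : Set (Fin m)) (D t c : ℕ) : Prop :=
  ∃ F : ∀ n, ViewType m n → ℕ, (∀ x, Valid V D t x → F t x < c) ∧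
    ∀ x y, Valid V D t x → Valid V D t y → Compat t x y → F t x ≠ F t y

/-- Some color below `c` can be realized by extending the view `x`, whichever neighbor is
prescribed. -/
def Flexible (V : Set (Fin m)) (D c : ℕ) (F : ∀ n, ViewType m n → ℕ) (n : ℕ)
    (x : ViewType m n) : Prop :=
  ∃ i < c, ∀ y, Valid V D n y → Compat n x y →
    ∃ S, y ∈ S ∧ Valid V D (n + 1) (extend x S) ∧ F (n + 1) (extend x S) = i

/-- The admissible sets of neighbors extending a view `x`. -/
def Admissible (V : Set (Fin m)) (D : ℕ) {n : ℕ} (x : ViewType m n) (p : Record m n)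
    (X : Set (ViewType m n)) : Prop :=
  (∀ y ∈ X, Valid V D n y ∧ Compat n x y) ∧ Covers n p X

theorem Admissible.valid_extend {V : Set (Fin m)} {D n : ℕ} {x : ViewType m n}
    {X : Set (ViewType m n)} (h : Admissible V D x (record n x) X) (hx : Valid V D n x)
    (hX : X.ncard ≤ D) : Valid V D (n + 1) (extend x X) :=
  ⟨hx, hX, h.1, h.2⟩

/-- The extension game: the adversary adds a set of at most `D₂` neighbors, and the player
enlarges it to a set of at most `D₁` neighbors. The player wins if after `k` moves the view
satisfies `P`. -/
def Winning (V : Set (Fin m)) (D₁ D₂ : ℕ) (P : ∀ n, ViewType m n → Prop) :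
    ℕ → (n : ℕ) → ViewType m n → Record m n → Prop
  | 0, n, x, _ => P n x
  | k + 1, n, x, p => ∀ X, Admissible V D₁ x p X → X.ncard ≤ D₂ →
      ∃ Y, X ⊆ Y ∧ Admissible V D₁ x (record n x) Y ∧ Y.ncard ≤ D₁ ∧
        Winning V D₁ D₂ P k (n + 1) (extend x Y) X

/-- The view obtained by enlarging neighborhoods according to a strategy, together with the
original record of the last round. -/
def enlarge (σ : ∀ n, ViewType m n → Record m n → Set (ViewType m n) → Set (ViewType m n)) :
    (n : ℕ) → ViewType m n → ViewType m n × Record m n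
  | 0, x => (x, ())
  | n + 1, x => (extend (enlarge σ n x.prev).1 (σ n (enlarge σ n x.prev).1 (enlarge σ n x.prev).2
      ((fun y => (enlarge σ n y).1) '' x.nbrs)), (fun y => (enlarge σ n y).1) '' x.nbrs)

theorem exists_winning_strategy (V : Set (Fin m)) (D₁ D₂ : ℕ) (P : ∀ n, ViewType m n → Prop)
    (t : ℕ) : ∃ σ : ∀ n, ViewType m n → Record m n → Set (ViewType m n) → Set (ViewType m n),
      ∀ k n, k + 1 + n = t → ∀ x p X, Winning V D₁ D₂ P (k + 1) n x p → Admissible V D₁ x p X →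
        X.ncard ≤ D₂ → X ⊆ σ n x p X ∧ Admissible V D₁ x (record n x) (σ n x p X) ∧
          (σ n x p X).ncard ≤ D₁ ∧ Winning V D₁ D₂ P k (n + 1) (extend x (σ n x p X)) X := by
  have h : ∀ n (x : ViewType m n) (p : Record m n) (X : Set (ViewType m n)),
      ∃ Y, ∀ k, k + 1 + n = t → Winning V D₁ D₂ P (k + 1) n x p → Admissible V D₁ x p X →
        X.ncard ≤ D₂ → X ⊆ Y ∧ Admissible V D₁ x (record n x) Y ∧
          Y.ncard ≤ D₁ ∧ Winning V D₁ D₂ P k (n + 1) (extend x Y) X := by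
    intro n x p X
    by_cases hX : n < t ∧ Winning V D₁ D₂ P (t - n - 1 + 1) n x p ∧ Admissible V D₁ x p X ∧
        X.ncard ≤ D₂
    · obtain ⟨hn, hw, ha, hc⟩ := hX
      obtain ⟨Y, hY⟩ := hw X ha hc
      refine ⟨Y, fun k hk _ _ _ => ?_⟩
      obtain rfl : k = t - n - 1 := by omega
      exact hY
    · refine ⟨X, fun k hk hw ha hc => absurd ⟨by omega, ?_, ha, hc⟩ hX⟩
      obtain rfl : k = t - n - 1 := by omega
      exact hw
  choose σ hσ using h
  exact ⟨σ, fun k n hk x p X hw ha hc => hσ n x p X k hk hw ha hc⟩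

theorem ViewColorable.of_winning {V V' : Set (Fin m)} {D D₁ D₂ t c : ℕ}
    {F : ∀ n, ViewType m n → ℕ} (hD : D₁ ≤ D) (hV : V' ⊆ V)
    (hF : ∀ x y, Valid V D (t + 1) x → Valid V D (t + 1) y → Compat (t + 1) x y →
      F (t + 1) x ≠ F (t + 1) y)
    (hw : ∀ v ∈ V', Winning V D₁ D₂ (Flexible V D c F) t 0 v ()) :
    ViewColorable V' D₂ t c := by
  classical
  obtain ⟨σ, hσ⟩ := exists_winning_strategy V D₁ D₂ (Flexible V D c F) t
  have key : ∀ n k, k + n = t → (∀ x, Valid V' D₂ n x → Valid V D₁ n (enlarge σ n x).1 ∧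
      Winning V D₁ D₂ (Flexible V D c F) k n (enlarge σ n x).1 (enlarge σ n x).2 ∧
      ∀ X, Covers n (record n x) X →
        Covers n (enlarge σ n x).2 ((fun y => (enlarge σ n y).1) '' X)) ∧
      ∀ x y, Valid V' D₂ n x → Valid V' D₂ n y → Compat n x y →
        Compat n (enlarge σ n x).1 (enlarge σ n y).1 := by
    intro n
    induction n with
    | zero =>
      rintro k rfl
      exact ⟨fun x hx => ⟨hV hx, hw x hx, fun _ _ => trivial⟩, fun x y _ _ h => h⟩
    | succ n ih =>
      intro k hk
      obtain ⟨ih1, ih2⟩ := ih (k + 1) (by omega)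
      have move : ∀ x, Valid V' D₂ (n + 1) x → _ := fun x hx =>
        hσ k n (by omega) (enlarge σ n x.prev).1 (enlarge σ n x.prev).2
          ((fun y => (enlarge σ n y).1) '' x.nbrs) (ih1 _ hx.1).2.1
          ⟨by
            rintro _ ⟨y, hy, rfl⟩
            exact ⟨(ih1 y (hx.2.2.1 y hy).1).1, ih2 _ _ hx.1 (hx.2.2.1 y hy).1 (hx.2.2.1 y hy).2⟩,
          (ih1 _ hx.1).2.2 _ hx.2.2.2⟩
          ((Set.ncard_image_le (Set.toFinite _)).trans hx.2.1)
      refine ⟨fun x hx => ⟨?_, (move x hx).2.2.2, ?_⟩, fun x y hx hy h => ⟨?_, ?_⟩⟩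
      · exact (move x hx).2.1.valid_extend (ih1 _ hx.1).1 (move x hx).2.2.1
      · intro X hX
        change prev '' _ = (fun y => (enlarge σ n y).1) '' x.nbrs
        have hX' : prev '' X = x.nbrs := hX
        rw [← hX', Set.image_image, Set.image_image]
        rfl
      · exact (move x hx).1 ⟨_, h.1, rfl⟩
      · exact (move y hy).1 ⟨_, h.2, rfl⟩
  obtain ⟨key1, key2⟩ := key t 0 (Nat.zero_add t)
  refine ⟨fun n x => if h : Flexible V D c F n (enlarge σ n x).1 then h.choose else 0, ?_, ?_⟩
  · intro x hx
    have hf : Flexible V D c F t (enlarge σ t x).1 := (key1 x hx).2.1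
    simp only [hf, dif_pos]
    exact hf.choose_spec.1
  · intro x y hx hy h heq
    have hfx : Flexible V D c F t (enlarge σ t x).1 := (key1 x hx).2.1
    have hfy : Flexible V D c F t (enlarge σ t y).1 := (key1 y hy).2.1
    simp only [hfx, hfy, dif_pos] at heq
    have hc := key2 x y hx hy h
    obtain ⟨S, hS, hSv, hSF⟩ := hfx.choose_spec.2 _ ((key1 y hy).1.mono hD) hc
    obtain ⟨T, hT, hTv, hTF⟩ := hfy.choose_spec.2 _ ((key1 x hx).1.mono hD) hc.symm
    exact hF _ _ hSv hTv ⟨hS, hT⟩ (by rw [hSF, hTF, heq])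

/-- If the player loses from every color in `Q`, the adversary can play all these games
simultaneously so that the resulting views are pairwise compatible. -/
theorem exists_losing_views {V : Set (Fin m)} {D₁ D₂ t : ℕ} {P : ∀ n, ViewType m n → Prop}
    {Q : Finset (Fin m)} (hQ : ∀ v ∈ Q, v ∈ V) (hD : D₂ + Q.card ≤ D₁)
    (hw : ∀ v ∈ Q, ¬ Winning V D₁ D₂ P t 0 v ()) :
    ∃ x : Fin m → ViewType m t, (∀ v ∈ Q, Valid V D₁ t (x v) ∧ ¬ P t (x v)) ∧
      ∀ v ∈ Q, ∀ u ∈ Q, u ≠ v → Compat t (x v) (x u) := by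
  have key : ∀ n k, k + n = t → ∃ (x : Fin m → ViewType m n) (p : Fin m → Record m n),
      (∀ v ∈ Q, Valid V D₁ n (x v) ∧ ¬ Winning V D₁ D₂ P k n (x v) (p v) ∧
        ∀ X, Covers n (p v) X → Covers n (record n (x v)) (X ∪ x '' {u | u ∈ Q ∧ u ≠ v})) ∧
      ∀ v ∈ Q, ∀ u ∈ Q, u ≠ v → Compat n (x v) (x u) := by
    intro n
    induction n with
    | zero =>
      rintro k rfl
      exact ⟨id, fun _ => (), fun v hv => ⟨hQ v hv, hw v hv, fun _ _ => trivial⟩,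
        fun v _ u _ h => h.symm⟩
    | succ n ih =>
      intro k hk
      obtain ⟨x, p, h1, h2⟩ := ih (k + 1) (by omega)
      have hX : ∀ v ∈ Q, ∃ X, Admissible V D₁ (x v) (p v) X ∧ X.ncard ≤ D₂ ∧
          ∀ Y, X ⊆ Y → Admissible V D₁ (x v) (record n (x v)) Y → Y.ncard ≤ D₁ →
            ¬ Winning V D₁ D₂ P k (n + 1) (extend (x v) Y) X := by
        intro v hv
        by_contra! hcon
        exact (h1 v hv).2.1 fun X hX hXc => by
          obtain ⟨Y, hY⟩ := hcon X hX hXc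
          exact ⟨Y, hY⟩
      choose! X hXa hXc hXw using hX
      set Y : Fin m → Set (ViewType m n) := fun v => X v ∪ x '' {u | u ∈ Q ∧ u ≠ v} with hY
      have hYa : ∀ v ∈ Q, Admissible V D₁ (x v) (record n (x v)) (Y v) := by
        refine fun v hv => ⟨?_, (h1 v hv).2.2 _ (hXa v hv).2⟩
        rintro y (hy | ⟨u, ⟨hu, huv⟩, rfl⟩)
        · exact (hXa v hv).1 y hy
        · exact ⟨(h1 u hu).1, h2 v hv u hu huv⟩
      have hYc : ∀ v ∈ Q, (Y v).ncard ≤ D₁ := by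
        intro v hv
        have h3 : (x '' {u | u ∈ Q ∧ u ≠ v}).ncard ≤ Q.card := by
          refine (Set.ncard_image_le (Set.toFinite _)).trans ?_
          rw [← Set.ncard_coe_finset Q]
          exact Set.ncard_le_ncard (fun u hu => hu.1) (Set.toFinite _)
        have h4 := Set.ncard_union_le (X v) (x '' {u | u ∈ Q ∧ u ≠ v})
        have h5 := hXc v hv
        change (X v ∪ x '' {u | u ∈ Q ∧ u ≠ v}).ncard ≤ D₁
        omega
      refine ⟨fun v => extend (x v) (Y v), X, fun v hv => ⟨?_, ?_, ?_⟩,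
        fun v hv u hu huv => ⟨?_, ?_⟩⟩
      · exact (hYa v hv).valid_extend (h1 v hv).1 (hYc v hv)
      · exact hXw v hv _ Set.subset_union_left (hYa v hv) (hYc v hv)
      · intro Z hZ
        change prev '' _ = Y v
        have hZ' : prev '' Z = X v := hZ
        rw [Set.image_union, hZ', Set.image_image]
        rfl
      · exact Or.inr ⟨u, ⟨hu, huv⟩, rfl⟩
      · exact Or.inr ⟨v, ⟨hv, huv.symm⟩, rfl⟩
  obtain ⟨x, p, h1, h2⟩ := key t 0 (Nat.zero_add t)
  exact ⟨x, fun v hv => ⟨(h1 v hv).1, (h1 v hv).2.1⟩, h2⟩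

/-- Among sufficiently many pairwise compatible views, at least one is flexible. -/
theorem exists_flexible {V : Set (Fin m)} {D D₁ t c k : ℕ} {F : ∀ n, ViewType m n → ℕ}
    (hFc : ∀ x, Valid V D (t + 1) x → F (t + 1) x < c)
    (hF : ∀ x y, Valid V D (t + 1) x → Valid V D (t + 1) y → Compat (t + 1) x y →
      F (t + 1) x ≠ F (t + 1) y)
    {Q : Finset (Fin m)} (hD₁ : 1 ≤ D₁) (hD : D₁ + Q.card ≤ D) {x : Fin m → ViewType m t}
    (hx : ∀ v ∈ Q, Valid V D₁ t (x v))
    (hxc : ∀ v ∈ Q, ∀ u ∈ Q, u ≠ v → Compat t (x v) (x u)) (hQ : 0 < Q.card)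
    (hk : 4 * k * c ≤ Q.card ^ 2)
    (hc : c * (Q.card - k) ^ (Q.card / 2) < Q.card ^ (Q.card / 2)) :
    ∃ v ∈ Q, Flexible V D c F t (x v) := by
  by_contra! hcon
  set R : ℕ → Fin m → Fin m → Prop := fun i v u => ∀ S, x u ∈ S →
    Valid V D (t + 1) (extend (x v) S) → F (t + 1) (extend (x v) S) ≠ i with hR
  obtain ⟨v, hv, T, hT, J, hJ, hTJ, hdom⟩ := exists_dominated_vertex Q c k R (by
    intro i _ u _ v _ _
    by_contra! h
    simp only [hR, not_forall, not_not] at h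
    obtain ⟨⟨S, hS, hSv, hSF⟩, T, hT, hTv, hTF⟩ := h
    exact hF _ _ hSv hTv ⟨hS, hT⟩ (hSF.trans hTF.symm)) hQ hk hc
  have hy : ∀ i ∈ J, ∃ y, Valid V D t y ∧ Compat t (x v) y ∧ ∀ S, y ∈ S →
      Valid V D (t + 1) (extend (x v) S) → F (t + 1) (extend (x v) S) ≠ i := by
    intro i hi
    by_contra! h
    exact hcon v hv ⟨i, Finset.mem_range.mp (hJ hi), fun y hy hyc => h y hy hyc⟩
  have : Nonempty (ViewType m t) := ⟨x v⟩
  choose! y hyv hyc hyF using hy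
  obtain ⟨S₀, hS₀c, hS₀, hS₀p⟩ := (hx v hv).exists_covers hD₁
  have hmem : ∀ z ∈ x '' {u | u ∈ T ∧ u ≠ v} ∪ y '' J, Valid V D t z ∧ Compat t (x v) z := by
    rintro _ (⟨u, ⟨hu, huv⟩, rfl⟩ | ⟨i, hi, rfl⟩)
    · exact ⟨(hx u (hT hu)).mono (by omega), hxc v hv u (hT hu) huv⟩
    · exact ⟨hyv i hi, hyc i hi⟩
  set S := S₀ ∪ (x '' {u | u ∈ T ∧ u ≠ v} ∪ y '' J) with hS
  have hScard : S.ncard ≤ D := by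
    have h1 : (x '' {u | u ∈ T ∧ u ≠ v}).ncard ≤ T.card := by
      refine (Set.ncard_image_le (Set.toFinite _)).trans ?_
      rw [← Set.ncard_coe_finset T]
      exact Set.ncard_le_ncard (fun u hu => hu.1) (Set.toFinite _)
    have h2 : (y '' (J : Set ℕ)).ncard ≤ J.card := by
      refine (Set.ncard_image_le (Set.toFinite _)).trans ?_
      rw [Set.ncard_coe_finset]
    have h3 := Set.ncard_union_le S₀ (x '' {u | u ∈ T ∧ u ≠ v} ∪ y '' J)
    have h4 := Set.ncard_union_le (x '' {u | u ∈ T ∧ u ≠ v}) (y '' (J : Set ℕ))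
    rw [hS]
    omega
  have hSa : Admissible V D (x v) (record t (x v)) S := by
    refine ⟨?_, hS₀p.union fun z hz => (hmem z hz).2⟩
    rintro z (hz | hz)
    · exact ⟨(hS₀ z hz).1.mono (by omega), (hS₀ z hz).2⟩
    · exact hmem z hz
  have hSv := hSa.valid_extend ((hx v hv).mono (by omega)) hScard
  rcases hdom _ (hFc _ hSv) with hi | ⟨u, hu, huv, hRu⟩
  · exact hyF _ hi S (Or.inr (Or.inr ⟨_, hi, rfl⟩)) hSv rfl
  · exact hRu S (Or.inr (Or.inl ⟨u, ⟨hu, huv⟩, rfl⟩)) hSv rfl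

/-- One round can be removed from a coloring algorithm at the cost of fewer than `s` input
colors and a slightly smaller degree. -/
theorem ViewColorable.pred {V : Set (Fin m)} {D t c k s : ℕ} (h : ViewColorable V D (t + 1) c)
    (hs : 0 < s) (hD : 2 * s + 1 ≤ D) (hk : 4 * k * c ≤ s ^ 2)
    (hc : c * (s - k) ^ (s / 2) < s ^ (s / 2)) :
    ∃ V' : Set (Fin m), V.ncard ≤ V'.ncard + s ∧ ViewColorable V' (D - 2 * s) t c := by
  obtain ⟨F, hFc, hF⟩ := h
  set V' : Set (Fin m) :=
    {v | v ∈ V ∧ Winning V (D - s) (D - 2 * s) (Flexible V D c F) t 0 v ()} with hV'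
  refine ⟨V', ?_, .of_winning (Nat.sub_le _ _) (fun v hv => hv.1) hF fun v hv => hv.2⟩
  by_contra! hlt
  have h1 : s ≤ (V \ V').ncard := by
    have := Set.ncard_le_ncard_sdiff_add_ncard V V' (Set.toFinite _)
    omega
  obtain ⟨Q, hQV, hQs⟩ := Set.exists_subset_card_eq h1
  obtain ⟨Q, rfl⟩ := (Set.toFinite Q).exists_finset_coe
  rw [Set.ncard_coe_finset] at hQs
  obtain ⟨x, hx1, hx2⟩ := exists_losing_views (D₂ := D - 2 * s) (fun v hv => (hQV hv).1)
    (by omega : D - 2 * s + Q.card ≤ D - s) fun v hv hw => (hQV hv).2 ⟨(hQV hv).1, hw⟩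
  subst hQs
  obtain ⟨v, hv, hfl⟩ := exists_flexible hFc hF (by omega : 1 ≤ D - Q.card) (by omega)
    (fun v hv => (hx1 v hv).1) hx2 hs hk hc
  exact (hx1 v hv).2 hfl

theorem ViewColorable.ncard_le {V : Set (Fin m)} {D t c k s : ℕ} (h : ViewColorable V D t c)
    (hs : 0 < s) (hD : 2 * t * s + 1 ≤ D) (hk : 4 * k * c ≤ s ^ 2)
    (hc : c * (s - k) ^ (s / 2) < s ^ (s / 2)) : V.ncard ≤ c + t * s := by
  induction t generalizing V D with
  | zero =>
    obtain ⟨F, hFc, hF⟩ := h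
    have : V.ncard ≤ (Set.Iio c).ncard := Set.ncard_le_ncard_of_injOn (F 0) (fun v hv => hFc v hv)
      (fun u hu v hv huv => by_contra fun hne => hF u v hu hv hne huv) (Set.toFinite _)
    simpa [Set.ncard_eq_toFinset_card'] using this
  | succ t ih =>
    have h3 : 2 * (t + 1) * s = 2 * t * s + 2 * s := by ring
    have h4 : (t + 1) * s = t * s + s := by ring
    obtain ⟨V', hV', h'⟩ := h.pred hs (by omega) hk hc
    have := ih h' (by omega)
    omega

theorem viewColorable_of_colorable {Δ r c : ℕ} (hΔ : 2 ≤ Δ) (h : (NSL m Δ r).Colorable c) :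
    ViewColorable (m := m) Set.univ (Δ - 1) r c := by
  classical
  obtain ⟨f⟩ := h
  refine ⟨fun n x => if h : ∃ e : n = r, IsView m Δ r (e ▸ x) then f ⟨h.1 ▸ x, h.2⟩ else 0,
    fun x hx => ?_, fun x y hx hy hxy => ?_⟩
  · have hx' : ∃ e : r = r, IsView m Δ r (e ▸ x) := ⟨rfl, hx.isView (by omega)⟩
    beta_reduce
    rw [dif_pos hx']
    exact (f _).2
  · have hx' : ∃ e : r = r, IsView m Δ r (e ▸ x) := ⟨rfl, hx.isView (by omega)⟩
    have hy' : ∃ e : r = r, IsView m Δ r (e ▸ y) := ⟨rfl, hy.isView (by omega)⟩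
    beta_reduce
    rw [dif_pos hx', dif_pos hy']
    refine fun heq => f.valid (v := ⟨x, hx'.2⟩) (w := ⟨y, hy'.2⟩) ?_ (Fin.ext heq)
    refine (SimpleGraph.fromRel_adj _ _ _).mpr ⟨fun he => ?_, Or.inl ?_⟩
    · exact hx.label_ne hxy (congrArg (label r) (congrArg Subtype.val he))
    · exact hx.viewAdj (by omega) (by omega) hy hxy

end Reduction

section Asymptotics

open Filter

theorem mul_tsub_pow_lt_pow {c k s : ℕ} (hs : 2 ≤ s) (hc : (c : ℝ) < Real.exp (k / 3)) :
    c * (s - k) ^ (s / 2) < s ^ (s / 2) := by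
  have hs0 : (0 : ℝ) < s := by positivity
  have h1 : ((s - k : ℕ) : ℝ) ≤ s * Real.exp (-(k / s)) := by
    rcases le_total s k with h | h
    · rw [Nat.sub_eq_zero_of_le h]
      simp only [Nat.cast_zero]
      positivity
    · have h2 := Real.add_one_le_exp (-(k / s : ℝ))
      calc ((s - k : ℕ) : ℝ) = s * (-(k / s) + 1) := by
            rw [Nat.cast_sub h]
            field_simp
            ring
        _ ≤ _ := by gcongr
  have h3 : Real.exp (-(k / s)) ^ (s / 2) ≤ Real.exp (-(k / 3)) := by
    rw [← Real.exp_nat_mul, Real.exp_le_exp]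
    have h4 : (s : ℝ) ≤ 3 * ((s / 2 : ℕ) : ℝ) := by
      have : s ≤ 3 * (s / 2) := by omega
      exact_mod_cast this
    have h5 : (k : ℝ) / 3 ≤ ((s / 2 : ℕ) : ℝ) * (k / s) := by
      rw [← mul_div_assoc, div_le_div_iff₀ (by norm_num) hs0]
      nlinarith [mul_le_mul_of_nonneg_left h4 (Nat.cast_nonneg k : (0 : ℝ) ≤ k)]
    linarith
  have h6 : (c : ℝ) * ((s - k : ℕ) : ℝ) ^ (s / 2) < (s : ℝ) ^ (s / 2) := by
    calc (c : ℝ) * ((s - k : ℕ) : ℝ) ^ (s / 2)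
        ≤ c * (s * Real.exp (-(k / s))) ^ (s / 2) := by gcongr
      _ = (s : ℝ) ^ (s / 2) * (c * Real.exp (-(k / s)) ^ (s / 2)) := by
          rw [mul_pow]
          ring
      _ ≤ (s : ℝ) ^ (s / 2) * (c * Real.exp (-(k / 3))) := by gcongr
      _ < (s : ℝ) ^ (s / 2) * (Real.exp (k / 3) * Real.exp (-(k / 3))) := by gcongr
      _ = (s : ℝ) ^ (s / 2) := by rw [← Real.exp_add, add_neg_cancel, Real.exp_zero, mul_one]
  exact_mod_cast h6

theorem half_le_natFloor {x : ℝ} (hx : 1 ≤ x) : x / 2 ≤ (⌊x⌋₊ : ℝ) := by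
  have h1 : (1 : ℝ) ≤ (⌊x⌋₊ : ℝ) := by exact_mod_cast Nat.le_floor (by simpa using hx)
  linarith [Nat.lt_floor_add_one x]

theorem eventually_mul_rpow_lt_exp {b : ℝ} (hb : 0 < b) (p C δ : ℝ) (hδ : 0 < δ) :
    ∀ᶠ x : ℝ in atTop, C * x ^ p < Real.exp (δ * x ^ b) := by
  have h1 : Tendsto (fun x : ℝ => C * (x ^ (p / b) * Real.exp (-δ * x))) atTop (nhds 0) := by
    simpa using (tendsto_rpow_mul_exp_neg_mul_atTop_nhds_zero (p / b) δ hδ).const_mul C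
  filter_upwards [(h1.comp (tendsto_rpow_atTop hb)).eventually_lt_const one_pos,
    eventually_ge_atTop 0] with x hx hx0
  simp only [Function.comp_apply, ← Real.rpow_mul hx0, mul_div_cancel₀ p hb.ne'] at hx
  rw [← mul_assoc, neg_mul, Real.exp_neg, ← div_eq_mul_inv, div_lt_one (Real.exp_pos _)] at hx
  exact hx

end Asymptotics

/-- (Main lower bound.) For all real constants `0 ≤ η < 1` and `C > 0` there are
`ε > 0` and a threshold `Δ₀` such that for all integers `Δ ≥ Δ₀`, `m ≥ 2CΔ^{1+η}`
and `1 ≤ r ≤ ε·Δ^{(1−η)/3}`, every proper coloring of the `SET-LOCAL` neighborhood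
graph `N^SL_r(m,Δ)` uses more than `C·Δ^{1+η}` colors; equivalently, no `r`-round
color reduction algorithm in the `SET-LOCAL` model with these parameters produces a
proper coloring with at most `C·Δ^{1+η}` colors. -/
theorem color_reduction_lower_bound (η C : ℝ) (hη0 : 0 ≤ η) (hη1 : η < 1)
    (hC : 0 < C) :
    ∃ ε : ℝ, 0 < ε ∧ ∃ Δ₀ : ℕ, ∀ Δ : ℕ, Δ₀ ≤ Δ → ∀ m : ℕ,
      2 * C * (Δ : ℝ) ^ ((1 : ℝ) + η) ≤ (m : ℝ) → ∀ r : ℕ, 1 ≤ r →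
      (r : ℝ) ≤ ε * (Δ : ℝ) ^ ((1 - η) / 3) → ∀ c : ℕ,
      (NSL m Δ r).Colorable c → C * (Δ : ℝ) ^ ((1 : ℝ) + η) < (c : ℝ) := by
  set a : ℝ := (2 + η) / 3 with ha
  set b : ℝ := (1 - η) / 3 with hb
  have ha0 : 0 < a := by rw [ha]; linarith
  have hb0 : 0 < b := by rw [hb]; linarith
  refine ⟨min (1 / 4) (C / 2), by positivity, ?_⟩
  have hev : ∀ᶠ Δ : ℕ in Filter.atTop, (2 ≤ (Δ : ℝ) ^ a ∧ 16 * C ≤ (Δ : ℝ) ^ b) ∧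
      C * (Δ : ℝ) ^ (1 + η) < Real.exp (1 / (96 * C) * (Δ : ℝ) ^ b) ∧ 4 ≤ Δ := by
    have hN := tendsto_natCast_atTop_atTop (R := ℝ)
    refine ((((tendsto_rpow_atTop ha0).comp hN).eventually_ge_atTop 2).and
      (((tendsto_rpow_atTop hb0).comp hN).eventually_ge_atTop (16 * C))).and
      ((hN.eventually (eventually_mul_rpow_lt_exp hb0 (1 + η) C (1 / (96 * C))
        (by positivity))).and (Filter.eventually_ge_atTop 4))
  obtain ⟨Δ₀, hΔ₀⟩ := Filter.eventually_atTop.mp hev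
  refine ⟨Δ₀, fun Δ hΔ m hm r _ hr c hcol => ?_⟩
  obtain ⟨⟨hΔa, hΔb⟩, hexp, hΔ4⟩ := hΔ₀ Δ hΔ
  by_contra! hc
  have hΔ0 : (0 : ℝ) < Δ := by positivity
  have hΔ1 : (1 : ℝ) ≤ Δ := by exact_mod_cast (by omega : 1 ≤ Δ)
  set s : ℕ := ⌊(Δ : ℝ) ^ a⌋₊ with hs
  set k : ℕ := ⌊(Δ : ℝ) ^ b / (16 * C)⌋₊ with hk
  have hs2 : 2 ≤ s := Nat.le_floor (by exact_mod_cast hΔa)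
  have hsle : (s : ℝ) ≤ (Δ : ℝ) ^ a := Nat.floor_le (by positivity)
  have hsge : (Δ : ℝ) ^ a / 2 ≤ s := half_le_natFloor (by linarith)
  have hkle : (k : ℝ) ≤ (Δ : ℝ) ^ b / (16 * C) := Nat.floor_le (by positivity)
  have hkge : (Δ : ℝ) ^ b / (16 * C) / 2 ≤ k :=
    half_le_natFloor ((one_le_div (by positivity)).mpr hΔb)
  have hkc : 4 * k * c ≤ s ^ 2 := by
    have h1 : (Δ : ℝ) ^ b * (Δ : ℝ) ^ (1 + η) = (Δ : ℝ) ^ a * (Δ : ℝ) ^ a := by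
      rw [← Real.rpow_add hΔ0, ← Real.rpow_add hΔ0]
      congr 1
      rw [ha, hb]
      ring
    have h2 : (4 * k * c : ℝ) ≤ s ^ 2 := by
      calc (4 * k * c : ℝ) ≤ 4 * ((Δ : ℝ) ^ b / (16 * C)) * (C * (Δ : ℝ) ^ (1 + η)) := by gcongr
        _ = (Δ : ℝ) ^ b * (Δ : ℝ) ^ (1 + η) / 4 := by
            field_simp
            ring
        _ = ((Δ : ℝ) ^ a / 2) ^ 2 := by
            rw [h1]
            ring
        _ ≤ s ^ 2 := by gcongr
    exact_mod_cast h2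
  have hcs : c * (s - k) ^ (s / 2) < s ^ (s / 2) := by
    refine mul_tsub_pow_lt_pow hs2 ((hc.trans_lt hexp).trans_le (Real.exp_le_exp.mpr ?_))
    have h1 : 1 / (96 * C) * (Δ : ℝ) ^ b = (Δ : ℝ) ^ b / (16 * C) / 2 / 3 := by
      field_simp
      norm_num
    linarith
  have hrs : (r * s : ℝ) ≤ min (1 / 4) (C / 2) * Δ := by
    calc (r * s : ℝ) ≤ min (1 / 4) (C / 2) * (Δ : ℝ) ^ b * (Δ : ℝ) ^ a := by gcongr
      _ = min (1 / 4) (C / 2) * Δ := by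
        rw [mul_assoc, ← Real.rpow_add hΔ0, show b + a = 1 by rw [ha, hb]; ring, Real.rpow_one]
  have hD : 2 * r * s + 1 ≤ Δ - 1 := by
    have h1 : (4 * (r * s) : ℝ) ≤ Δ := by
      nlinarith [mul_le_mul_of_nonneg_right (min_le_left (1 / 4 : ℝ) (C / 2)) hΔ0.le]
    have h2 : 4 * (r * s) ≤ Δ := by exact_mod_cast h1
    rw [mul_assoc]
    omega
  have hm' := (viewColorable_of_colorable (by omega) hcol).ncard_le (by omega) hD hkc hcs
  rw [Set.ncard_univ, Nat.card_fin] at hm'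
  have hm'' : (m : ℝ) ≤ c + r * s := by exact_mod_cast hm'
  have hpow : (Δ : ℝ) ≤ (Δ : ℝ) ^ (1 + η) := by
    simpa using Real.rpow_le_rpow_of_exponent_le hΔ1 (by linarith : (1 : ℝ) ≤ 1 + η)
  have h1 := mul_le_mul_of_nonneg_right (min_le_right (1 / 4 : ℝ) (C / 2)) hΔ0.le
  nlinarith [mul_le_mul_of_nonneg_left hpow hC.le, mul_pos hC hΔ0]
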